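/- Let V be a finite-dimensional real inner product space, X ∈ V with ‖X‖ < 1/2, and let F be the Matsumoto metric F(u) = ⟨u,u⟩/(√⟨u,u⟩ − ⟨X,u⟩) with fundamental tensor g_y. Then for all orthonormal y, v ∈ V, writing F = F(y) = 1/(1 − ⟨X,y⟩), one has g_y(y,y)·g_y(v,v) − g_y(y,v)² = 2F⁴ + 2F⁶⟨X,v⟩² − F⁵. -/

import Mathlib

open scoped RealInnerProductSpace

/-- The Matsumoto metric `F(u) = ⟨u,u⟩ / (√⟨u,u⟩ − ⟨X,u⟩)` on a real inner product
space. -/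
noncomputable def matsumotoMetric {V : Type*} [NormedAddCommGroup V]
    [InnerProductSpace ℝ V] (X : V) (u : V) : ℝ :=
  ⟪u, u⟫ / (Real.sqrt ⟪u, u⟫ - ⟪X, u⟫)

/-- The fundamental tensor of a Finsler norm `F` at `y`:
`g_y(u,w) = (1/2) ∂²/∂s∂t [F(y + s u + t w)²]` at `s = t = 0`. -/
noncomputable def fundamentalTensor {V : Type*} [NormedAddCommGroup V]
    [InnerProductSpace ℝ V] (F : V → ℝ) (y u w : V) : ℝ :=
  (1 / 2) * deriv (fun s : ℝ => deriv (fun t : ℝ => (F (y + s • u + t • w)) ^ 2) 0) 0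

section Matsumoto

variable {V : Type*} [NormedAddCommGroup V] [InnerProductSpace ℝ V]

lemma hasDerivAt_inner_add_smul (a z w : V) (t : ℝ) :
    HasDerivAt (fun t : ℝ => ⟪a, z + t • w⟫) ⟪a, w⟫ t := by
  simp only [inner_add_right, real_inner_smul_right]
  simpa using ((hasDerivAt_id t).mul_const ⟪a, w⟫).const_add ⟪a, z⟫

lemma hasDerivAt_inner_self_add_smul (z w : V) :
    HasDerivAt (fun t : ℝ => ⟪z + t • w, z + t • w⟫) (2 * ⟪z, w⟫) 0 := by
  have hline : HasDerivAt (fun t : ℝ => z + t • w) w 0 := by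
    simpa using ((hasDerivAt_id (0 : ℝ)).smul_const w).const_add z
  refine (hline.inner ℝ hline).congr_deriv ?_
  simp [real_inner_comm, two_mul]

/-- The directional derivative of the square of the Matsumoto metric. -/
lemma hasDerivAt_matsumotoMetric_sq (X z w : V) (hz : ⟪z, z⟫ ≠ 0)
    (hD : √⟪z, z⟫ - ⟪X, z⟫ ≠ 0) :
    HasDerivAt (fun t : ℝ => matsumotoMetric X (z + t • w) ^ 2)
      (4 * ⟪z, z⟫ * ⟪z, w⟫ / (√⟪z, z⟫ - ⟪X, z⟫) ^ 2 -
        2 * ⟪z, z⟫ ^ 2 * (⟪z, w⟫ / √⟪z, z⟫ - ⟪X, w⟫) / (√⟪z, z⟫ - ⟪X, z⟫) ^ 3) 0 := by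
  have hA := hasDerivAt_inner_self_add_smul z w
  have hr := hA.sqrt (by simpa using hz)
  have h := (hA.div (hr.sub (hasDerivAt_inner_add_smul X z w 0)) (by simpa using hD)).pow 2
  refine h.congr_deriv ?_
  have hr0 : √⟪z, z⟫ ≠ 0 :=
    Real.sqrt_ne_zero'.2 (lt_of_le_of_ne real_inner_self_nonneg hz.symm)
  simp only [zero_smul, add_zero, Pi.div_apply, Pi.sub_apply, Nat.reduceSub, pow_one,
    Nat.cast_ofNat]
  field_simp
  ring

/-- The fundamental tensor of the Matsumoto metric at a unit vector. -/
lemma fundamentalTensor_matsumotoMetric (X y u w : V) (hy : ⟪y, y⟫ = 1)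
    (hD : 1 - ⟪X, y⟫ ≠ 0) :
    fundamentalTensor (matsumotoMetric X) y u w =
      (4 * ⟪y, u⟫ * ⟪y, w⟫ + 2 * ⟪u, w⟫) / (1 - ⟪X, y⟫) ^ 2 -
      (4 * ⟪y, w⟫ * (⟪y, u⟫ - ⟪X, u⟫) + 4 * ⟪y, u⟫ * (⟪y, w⟫ - ⟪X, w⟫) +
        (⟪u, w⟫ - ⟪y, u⟫ * ⟪y, w⟫)) / (1 - ⟪X, y⟫) ^ 3 +
      3 * (⟪y, u⟫ - ⟪X, u⟫) * (⟪y, w⟫ - ⟪X, w⟫) / (1 - ⟪X, y⟫) ^ 4 := by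
  have hA0 : ⟪y + (0 : ℝ) • u, y + (0 : ℝ) • u⟫ ≠ 0 := by
    rw [zero_smul, add_zero, hy]
    exact one_ne_zero
  have hr0 : √⟪y + (0 : ℝ) • u, y + (0 : ℝ) • u⟫ ≠ 0 := by
    rw [zero_smul, add_zero, hy, Real.sqrt_one]
    exact one_ne_zero
  have hD0 : √⟪y + (0 : ℝ) • u, y + (0 : ℝ) • u⟫ - ⟪X, y + (0 : ℝ) • u⟫ ≠ 0 := by
    rwa [zero_smul, add_zero, hy, Real.sqrt_one]
  have hA := hasDerivAt_inner_self_add_smul y u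
  have hr := hA.sqrt hA0
  have hden := hr.sub (hasDerivAt_inner_add_smul X y u 0)
  have hp : HasDerivAt (fun s : ℝ => ⟪y + s • u, w⟫) ⟪u, w⟫ 0 := by
    simpa only [real_inner_comm] using hasDerivAt_inner_add_smul w y u 0
  have hev := (hA.continuousAt.eventually_ne hA0).and
    (hden.continuousAt.eventually_ne hD0)
  have hderiv : (fun s : ℝ => deriv (fun t : ℝ =>
      matsumotoMetric X (y + s • u + t • w) ^ 2) 0) =ᶠ[nhds 0] _ :=
    hev.mono fun s hs => (hasDerivAt_matsumotoMetric_sq X (y + s • u) w hs.1 hs.2).deriv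
  have h := (((hA.const_mul 4).mul hp).div (hden.pow 2) (pow_ne_zero 2 hD0)).sub
    ((((hA.pow 2).const_mul 2).mul ((hp.div hr hr0).sub_const ⟪X, w⟫)).div
      (hden.pow 3) (pow_ne_zero 3 hD0))
  rw [fundamentalTensor, hderiv.deriv_eq]
  refine (congrArg _ h.deriv).trans ?_
  simp only [zero_smul, add_zero, Pi.div_apply, Pi.sub_apply, Pi.mul_apply, Pi.pow_apply, hy,
    Real.sqrt_one]
  field_simp
  ring

end Matsumoto

/-- Let `V` be a finite-dimensional real inner product space,
`X ∈ V` with `‖X‖ < 1/2`, and `F` the Matsumoto metric with fundamental tensor `g_y`.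
For orthonormal `y, v`, writing `F = F(y) = 1/(1 − ⟨X,y⟩)`, one has
`g_y(y,y) g_y(v,v) − g_y(y,v)² = 2F⁴ + 2F⁶⟨X,v⟩² − F⁵`. -/
theorem matsumoto_fundamental_tensor_determinant
    {V : Type*} [NormedAddCommGroup V] [InnerProductSpace ℝ V]
    [FiniteDimensional ℝ V]
    (X : V) (hX : ‖X‖ < 1 / 2)
    (y v : V) (hy : ⟪y, y⟫ = 1) (hv : ⟪v, v⟫ = 1) (hyv : ⟪y, v⟫ = 0)
    (F : ℝ) (hF : F = 1 / (1 - ⟪X, y⟫)) :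
    fundamentalTensor (matsumotoMetric X) y y y *
          fundamentalTensor (matsumotoMetric X) y v v -
        (fundamentalTensor (matsumotoMetric X) y y v) ^ 2 =
      2 * F ^ 4 + 2 * F ^ 6 * ⟪X, v⟫ ^ 2 - F ^ 5 := by
  have hy1 : ‖y‖ = 1 := by
    have h := real_inner_self_eq_norm_sq y
    rw [hy] at h
    nlinarith [norm_nonneg y]
  have hD : 1 - ⟪X, y⟫ ≠ 0 := by
    have h := real_inner_le_norm X y
    rw [hy1] at h
    linarith
  simp only [fundamentalTensor_matsumotoMetric X y _ _ hy hD, hy, hv, hyv, hF]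
  field_simp
  ring
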